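/- Let f : (−1,1) → ℝ be piecewise Lipschitz, extended by zero; set τ := 𝓗(arctan∘f) and t₀(x) := e^{τ(x)}/(π·√(1−x²)·√(1+f(x)²)) for x ∈ (−1,1), t₀ := 0 outside. For z ∈ ℂ with Im z > 0 define φ⁺(z) := (1/π)·∫_{−1}^1 (π/2 + arctan f(s))/(s − z) ds and φ⁻(z) := (1/π)·∫_{−1}^1 (−π/2 + arctan f(s))/(s − z) ds. Then for every z ∈ ℂ with Im z > 0: (1/π)·∫_{−1}^1 t₀(s)/(s − z) ds = (1/(2π))·( e^{φ⁺(z)} − e^{φ⁻(z)} ). -/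

import Mathlib

open MeasureTheory Filter Set Complex
open scoped Real Topology ENNReal

/-- Hilbert transform: `HT h x = -(1/π) · lim_{ε→0⁺} ∫_{|x-s|>ε} h(s)/(x-s) ds`. -/
noncomputable def HT (h : ℝ → ℝ) (x : ℝ) : ℝ :=
  limUnder (𝓝[>] (0:ℝ)) (fun ε : ℝ =>
    -(1 / Real.pi) * ∫ s in {s : ℝ | ε < |x - s|}, h s / (x - s))

/-- A piecewise Lipschitz function on `(-1,1)`. -/
def PiecewiseLipschitzOn (f : ℝ → ℝ) : Prop :=
  ∃ (m : ℕ) (y : ℕ → ℝ), 0 < m ∧ y 0 = -1 ∧ y m = 1 ∧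
    (∀ j, j < m → y j < y (j + 1)) ∧
    ∀ j, j < m → ∃ K : NNReal, LipschitzOnWith K f (Set.Ioo (y j) (y (j + 1)))

/-- The kernel `Im z / |s - z|²` of the upper half-plane, i.e. `π` times the Poisson kernel. -/
noncomputable def halfPlaneKernel (z : ℂ) (s : ℝ) : ℝ :=
  z.im / ((s - z.re) ^ 2 + z.im ^ 2)

section Kernel

variable {z : ℂ}

lemma halfPlaneKernel_denom_pos (hz : 0 < z.im) (s : ℝ) : 0 < (s - z.re) ^ 2 + z.im ^ 2 := by
  positivity

lemma halfPlaneKernel_pos (hz : 0 < z.im) (s : ℝ) : 0 < halfPlaneKernel z s :=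
  div_pos hz (halfPlaneKernel_denom_pos hz s)

lemma continuous_halfPlaneKernel (hz : 0 < z.im) : Continuous (halfPlaneKernel z) :=
  continuous_const.div (by fun_prop) fun s => (halfPlaneKernel_denom_pos hz s).ne'

lemma halfPlaneKernel_eq_inv_one_add_sq (hz : 0 < z.im) (s : ℝ) :
    halfPlaneKernel z s = z.im⁻¹ * (1 + (z.im⁻¹ * (s - z.re)) ^ 2)⁻¹ := by
  have h := halfPlaneKernel_denom_pos hz s
  unfold halfPlaneKernel
  field_simp
  ring

lemma integrable_halfPlaneKernel (hz : 0 < z.im) : Integrable (halfPlaneKernel z) := by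
  have h := ((integrable_inv_one_add_sq.comp_mul_left' (inv_ne_zero hz.ne')).comp_sub_right
    z.re).const_mul z.im⁻¹
  exact h.congr (.of_forall fun s => (halfPlaneKernel_eq_inv_one_add_sq hz s).symm)

lemma integral_halfPlaneKernel (hz : 0 < z.im) : ∫ s, halfPlaneKernel z s = π := by
  simp_rw [halfPlaneKernel_eq_inv_one_add_sq hz, integral_const_mul]
  rw [integral_sub_right_eq_self (fun u : ℝ => (1 + (z.im⁻¹ * u) ^ 2)⁻¹) z.re,
    Measure.integral_comp_mul_left (fun u : ℝ => (1 + u ^ 2)⁻¹), integral_univ_inv_one_add_sq,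
    inv_inv, abs_of_pos hz, smul_eq_mul]
  field_simp

lemma ofReal_sub_ne_zero (hz : 0 < z.im) (s : ℝ) : (s : ℂ) - z ≠ 0 := fun h => by
  have := congrArg Complex.im h
  simp at this
  exact hz.ne' this

lemma ofReal_sub_conj_ne_zero (hz : 0 < z.im) {w : ℂ} (hw : 0 ≤ w.im) :
    w - (starRingEnd ℂ) z ≠ 0 := fun h => by
  have := congrArg Complex.im h
  simp at this
  linarith

lemma norm_ofReal_sub_sq (z : ℂ) (s : ℝ) :
    ‖(s : ℂ) - z‖ ^ 2 = (s - z.re) ^ 2 + z.im ^ 2 := by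
  rw [← normSq_eq_norm_sq, normSq_apply]
  simp
  ring

lemma im_le_norm_ofReal_sub (hz : 0 < z.im) (s : ℝ) : z.im ≤ ‖(s : ℂ) - z‖ := by
  have := abs_im_le_norm ((s : ℂ) - z)
  simpa [abs_of_pos hz] using this

lemma im_ofReal_div_sub (z : ℂ) (g s : ℝ) :
    ((g : ℂ) / ((s : ℂ) - z)).im = g * halfPlaneKernel z s := by
  rw [halfPlaneKernel, ← norm_ofReal_sub_sq, ← normSq_eq_norm_sq, div_eq_mul_inv, im_ofReal_mul,
    inv_im]
  simp

lemma halfPlaneKernel_complex (z : ℂ) (s : ℝ) :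
    ((halfPlaneKernel z s : ℝ) : ℂ)
      = (z.im : ℂ) / (((s : ℂ) - z) * ((s : ℂ) - (starRingEnd ℂ) z)) := by
  have : ((s : ℂ) - z) * ((s : ℂ) - (starRingEnd ℂ) z) = (((s - z.re) ^ 2 + z.im ^ 2 : ℝ) : ℂ) := by
    rw [← norm_ofReal_sub_sq, ← normSq_eq_norm_sq, ← mul_conj]
    simp
  rw [this, halfPlaneKernel]
  push_cast
  rfl

end Kernel

section CauchyTransform

variable {μ : Measure ℝ} {g : ℝ → ℝ} {z : ℂ}

lemma norm_ofReal_div_sub_le (hz : 0 < z.im) (s : ℝ) :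
    ‖(g s : ℂ) / ((s : ℂ) - z)‖ ≤ |g s| / z.im := by
  rw [norm_div, norm_real, Real.norm_eq_abs]
  gcongr
  exact im_le_norm_ofReal_sub hz s

lemma continuous_inv_ofReal_sub (hz : 0 < z.im) : Continuous fun s : ℝ => ((s : ℂ) - z)⁻¹ :=
  (by fun_prop : Continuous fun s : ℝ => (s : ℂ) - z).inv₀ (ofReal_sub_ne_zero hz)

lemma integrable_cauchyTransform (hg : Integrable g μ) (hz : 0 < z.im) :
    Integrable (fun s => (g s : ℂ) / ((s : ℂ) - z)) μ := by
  refine (hg.abs.div_const z.im).mono' ?_ (.of_forall fun s => norm_ofReal_div_sub_le hz s)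
  simp_rw [div_eq_mul_inv]
  exact hg.ofReal.aestronglyMeasurable.mul
    (continuous_inv_ofReal_sub hz).aestronglyMeasurable

lemma norm_cauchyTransform_le (hg : Integrable g μ) (hz : 0 < z.im) :
    ‖∫ s, (g s : ℂ) / ((s : ℂ) - z) ∂μ‖ ≤ (∫ s, |g s| ∂μ) / z.im := by
  rw [← integral_div]
  exact norm_integral_le_of_norm_le (hg.abs.div_const _)
    (.of_forall fun s => norm_ofReal_div_sub_le hz s)

lemma im_cauchyTransform (hg : Integrable g μ) (hz : 0 < z.im) :
    (∫ s, (g s : ℂ) / ((s : ℂ) - z) ∂μ).im = ∫ s, g s * halfPlaneKernel z s ∂μ := by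
  have h := integral_im (𝕜 := ℂ) (integrable_cauchyTransform hg hz)
  simp only [RCLike.im_eq_complex_im, im_ofReal_div_sub] at h
  exact h.symm

lemma differentiableOn_cauchyTransform (hg : Integrable g μ) :
    DifferentiableOn ℂ (fun z => ∫ s, (g s : ℂ) / ((s : ℂ) - z) ∂μ) {z | 0 < z.im} := by
  intro z hz
  have hz : 0 < z.im := hz
  have hs : {w : ℂ | z.im / 2 < w.im} ∈ 𝓝 z :=
    (isOpen_lt continuous_const Complex.continuous_im).mem_nhds
      (show z.im / 2 < z.im by linarith)
  have hpos : ∀ w ∈ {w : ℂ | z.im / 2 < w.im}, 0 < w.im := fun w hw => by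
    have : z.im / 2 < w.im := hw
    linarith
  refine (hasDerivAt_integral_of_dominated_loc_of_deriv_le
    (F' := fun w s => (g s : ℂ) / ((s : ℂ) - w) ^ 2)
    (bound := fun s => |g s| / (z.im / 2) ^ 2) hs ?_ (integrable_cauchyTransform hg hz) ?_ ?_
    (hg.abs.div_const _) ?_).2.differentiableAt.differentiableWithinAt
  · filter_upwards [hs] with w hw
      using (integrable_cauchyTransform hg (hpos w hw)).aestronglyMeasurable
  · simp_rw [div_eq_mul_inv, ← inv_pow]
    exact hg.ofReal.aestronglyMeasurable.mul
      ((continuous_inv_ofReal_sub hz).pow 2).aestronglyMeasurable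
  · refine .of_forall fun s w hw => ?_
    have hw' : z.im / 2 < w.im := hw
    rw [norm_div, norm_real, Real.norm_eq_abs, norm_pow]
    gcongr
    exact hw'.le.trans (im_le_norm_ofReal_sub (hpos w hw) s)
  · refine .of_forall fun s w hw => ?_
    have hne := ofReal_sub_ne_zero (hpos w hw) s
    have h := ((hasDerivAt_id w).const_sub (s : ℂ)).inv hne
    simpa [div_eq_mul_inv] using h.const_mul (g s : ℂ)

lemma im_cauchyTransform_mem_Icc {S : Set ℝ} {a b : ℝ} (hg : IntegrableOn g S)
    (ha : a ≤ 0) (hb : 0 ≤ b) (hgab : ∀ᵐ s ∂volume.restrict S, a ≤ g s ∧ g s ≤ b)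
    (hz : 0 < z.im) :
    ((1 / (π : ℂ)) * ∫ s in S, (g s : ℂ) / ((s : ℂ) - z)).im ∈ Set.Icc a b := by
  have hcast : (1 / (π : ℂ)) = ((π⁻¹ : ℝ) : ℂ) := by push_cast; simp
  rw [hcast, im_ofReal_mul, im_cauchyTransform hg hz]
  have hk : ∫ s in S, halfPlaneKernel z s ≤ π :=
    (setIntegral_le_integral (integrable_halfPlaneKernel hz)
      (.of_forall fun s => (halfPlaneKernel_pos hz s).le)).trans_eq (integral_halfPlaneKernel hz)
  have hkS : IntegrableOn (halfPlaneKernel z) S := (integrable_halfPlaneKernel hz).integrableOn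
  have hInt : IntegrableOn (fun s => g s * halfPlaneKernel z s) S := by
    have := (integrable_cauchyTransform hg hz).im
    refine this.congr (.of_forall fun s => ?_)
    simp [im_ofReal_div_sub]
  have hlo : a * ∫ s in S, halfPlaneKernel z s ≤ ∫ s in S, g s * halfPlaneKernel z s := by
    rw [← integral_const_mul]
    refine integral_mono_ae (hkS.const_mul a) hInt ?_
    filter_upwards [hgab] with s hs
    exact mul_le_mul_of_nonneg_right hs.1 (halfPlaneKernel_pos hz s).le
  have hhi : ∫ s in S, g s * halfPlaneKernel z s ≤ b * ∫ s in S, halfPlaneKernel z s := by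
    rw [← integral_const_mul]
    refine integral_mono_ae hInt (hkS.const_mul b) ?_
    filter_upwards [hgab] with s hs
    exact mul_le_mul_of_nonneg_right hs.2 (halfPlaneKernel_pos hz s).le
  have hπ := Real.pi_pos
  constructor
  · rw [← div_eq_inv_mul, le_div_iff₀ hπ]
    nlinarith
  · rw [← div_eq_inv_mul, div_le_iff₀ hπ]
    nlinarith

end CauchyTransform

section Contour

/-- Cauchy's theorem in the upper half-plane for functions decaying like `|w|⁻²`. -/
lemma integrable_and_integral_eq_zero_of_decay {G : ℂ → ℂ} {C : ℝ}
    (hG : DifferentiableOn ℂ G {w | 0 ≤ w.im})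
    (hbound : ∀ w : ℂ, 0 ≤ w.im → ‖G w‖ ≤ C / (1 + ‖w‖ ^ 2)) :
    Integrable (fun x : ℝ => G x) ∧ ∫ x : ℝ, G x = 0 := by
  have hcont : Continuous fun x : ℝ => G x :=
    hG.continuousOn.comp_continuous continuous_ofReal fun x => by simp
  have hInt : Integrable fun x : ℝ => G x := by
    refine (integrable_inv_one_add_sq.const_mul C).mono' hcont.aestronglyMeasurable
      (.of_forall fun x => ?_)
    simpa [div_eq_mul_inv] using hbound x (by simp)
  refine ⟨hInt, ?_⟩
  have hC : 0 ≤ C := by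
    have := (norm_nonneg _).trans (hbound 0 (by simp))
    simpa using this
  have hlim := intervalIntegral_tendsto_integral hInt tendsto_neg_atTop_atBot tendsto_id
  refine tendsto_nhds_unique hlim (squeeze_zero_norm' (a := fun R : ℝ => 4 * C * R⁻¹) ?_ ?_)
  swap
  · simpa using tendsto_inv_atTop_zero.const_mul (4 * C)
  filter_upwards [eventually_gt_atTop 0] with R hR
  have hside : ∀ w : ℂ, 0 ≤ w.im → R ≤ ‖w‖ → ‖G w‖ ≤ C / R ^ 2 := fun w hw hRw =>
    (hbound w hw).trans (div_le_div_of_nonneg_left hC (by positivity) (by nlinarith))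
  have hrect := integral_boundary_rect_eq_zero_of_differentiableOn G (-R : ℝ) (R + R * I) <| by
    refine hG.mono fun w hw => ?_
    have := hw.2
    simp only [ofReal_im, add_im, mul_im, ofReal_re, I_im, I_re, mul_one, mul_zero, add_zero,
      zero_add, uIcc_of_le hR.le, Set.mem_preimage, Set.mem_Icc] at this
    exact this.1
  simp only [ofReal_re, ofReal_im, add_re, add_im, mul_re, mul_im, I_re, I_im, mul_zero, mul_one,
    add_zero, zero_add, ofReal_zero, zero_mul, sub_self] at hrect
  have htop : ‖∫ x : ℝ in (-R)..R, G (x + R * I)‖ ≤ C / R ^ 2 * |R - -R| :=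
    intervalIntegral.norm_integral_le_of_norm_le_const fun x _ => hside _ (by simp [hR.le]) <| by
      simpa [abs_of_pos hR] using abs_im_le_norm (x + R * I : ℂ)
  have hvert : ∀ c : ℝ, |c| = R → ‖∫ y : ℝ in (0 : ℝ)..R, G (c + y * I)‖ ≤ C / R ^ 2 * |R - 0| :=
    fun c hc => intervalIntegral.norm_integral_le_of_norm_le_const fun y hy =>
      hside _ (by
        rw [uIoc_of_le hR.le] at hy
        simpa using hy.1.le) (by simpa [hc] using abs_re_le_norm (c + y * I : ℂ))
  have hR1 := hvert R (abs_of_pos hR)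
  have hR2 := hvert (-R) (by rw [abs_neg, abs_of_pos hR])
  have heq : ∫ x : ℝ in (-R)..R, G x = (∫ x : ℝ in (-R)..R, G (x + R * I))
      - I • (∫ y : ℝ in (0 : ℝ)..R, G (R + y * I))
      + I • ∫ y : ℝ in (0 : ℝ)..R, G ((-R : ℝ) + y * I) := by
    linear_combination hrect
  simp only [id]
  rw [heq]
  have e1 : |R - -R| = 2 * R := by rw [sub_neg_eq_add, abs_of_pos (by linarith)]; ring
  rw [e1] at htop
  rw [sub_zero, abs_of_pos hR] at hR1 hR2
  calc _ ≤ C / R ^ 2 * (2 * R) + C / R ^ 2 * R + C / R ^ 2 * R := by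
        refine (norm_add_le _ _).trans (add_le_add ((norm_sub_le _ _).trans (add_le_add htop ?_)) ?_)
        · simpa [norm_smul] using hR1
        · simpa [norm_smul] using hR2
    _ = 4 * C * R⁻¹ := by field_simp; ring

lemma exists_decay_bound {G : ℂ → ℂ} {C ρ : ℝ} (hG : ContinuousOn G {w | 0 ≤ w.im})
    (hbound : ∀ w : ℂ, 0 ≤ w.im → ρ ≤ ‖w‖ → ‖G w‖ ≤ C / (1 + ‖w‖ ^ 2)) :
    ∃ C', ∀ w : ℂ, 0 ≤ w.im → ‖G w‖ ≤ C' / (1 + ‖w‖ ^ 2) := by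
  have hK : IsCompact (Metric.closedBall (0 : ℂ) ρ ∩ {w | 0 ≤ w.im}) :=
    (isCompact_closedBall 0 ρ).inter_right (isClosed_le continuous_const Complex.continuous_im)
  have hcont : ContinuousOn (fun w : ℂ => G w * (1 + ‖w‖ ^ 2 : ℝ))
      (Metric.closedBall (0 : ℂ) ρ ∩ {w | 0 ≤ w.im}) :=
    (hG.mono inter_subset_right).mul (by fun_prop)
  obtain ⟨B, hB⟩ := hK.exists_bound_of_continuousOn hcont
  refine ⟨max C B, fun w hw => ?_⟩
  rcases le_total ρ ‖w‖ with h | h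
  · exact (hbound w hw h).trans (by gcongr; exact le_max_left _ _)
  · rw [le_div_iff₀ (by positivity)]
    refine le_trans ?_ ((hB w ⟨by simpa using h, hw⟩).trans (le_max_right _ _))
    rw [norm_mul, norm_real, Real.norm_of_nonneg (by positivity)]

/-- The Poisson formula for bounded holomorphic functions on the closed upper half-plane. -/
lemma integral_halfPlaneKernel_mul {H : ℂ → ℂ} {C : ℝ} {z : ℂ} (hz : 0 < z.im)
    (hH : DifferentiableOn ℂ H {w | 0 ≤ w.im}) (hbound : ∀ w : ℂ, 0 ≤ w.im → ‖H w‖ ≤ C) :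
    ∫ s : ℝ, (halfPlaneKernel z s : ℂ) * H s = π * H z := by
  have hnhds : {w : ℂ | 0 ≤ w.im} ∈ 𝓝 z :=
    mem_of_superset ((isOpen_lt continuous_const Complex.continuous_im).mem_nhds hz)
      fun w (hw : 0 < w.im) => hw.le
  set G : ℂ → ℂ := fun w => dslope H z w * (z.im / (w - (starRingEnd ℂ) z)) with hGdef
  have hG : DifferentiableOn ℂ G {w | 0 ≤ w.im} :=
    ((differentiableOn_dslope hnhds).mpr hH).mul <|
      (differentiableOn_const _).div (by fun_prop) fun w hw => ofReal_sub_conj_ne_zero hz hw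
  have hC : 0 ≤ C := (norm_nonneg _).trans (hbound z hz.le)
  obtain ⟨C', hC'⟩ := exists_decay_bound (C := 16 * C * z.im) (ρ := 2 * ‖z‖ + 1) hG.continuousOn
    fun w hw hρ => by
      have hz0 := norm_nonneg z
      have h1 : ‖w‖ / 2 ≤ ‖w - z‖ := by
        have := norm_sub_norm_le w z
        linarith
      have h2 : ‖w‖ / 2 ≤ ‖w - (starRingEnd ℂ) z‖ := by
        have := norm_sub_norm_le w ((starRingEnd ℂ) z)
        rw [RCLike.norm_conj] at this
        linarith
      have hwz : w ≠ z := by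
        rintro rfl
        linarith
      have h3 : ‖H w - H z‖ ≤ 2 * C :=
        (norm_sub_le _ _).trans (by linarith [hbound w hw, hbound z hz.le])
      have hw0 : 0 < ‖w‖ := by linarith
      rw [hGdef]
      simp only [dslope_of_ne _ hwz, slope, vsub_eq_sub, norm_mul, norm_smul, norm_div, norm_inv,
        norm_real, Real.norm_eq_abs, abs_of_pos hz]
      calc ‖w - z‖⁻¹ * ‖H w - H z‖ * (z.im / ‖w - (starRingEnd ℂ) z‖)
          ≤ (‖w‖ / 2)⁻¹ * (2 * C) * (z.im / (‖w‖ / 2)) := by gcongr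
        _ = 16 * C * z.im / (2 * ‖w‖ ^ 2) := by field_simp; ring
        _ ≤ 16 * C * z.im / (1 + ‖w‖ ^ 2) := by
          gcongr
          nlinarith
  obtain ⟨hGi, hG0⟩ := integrable_and_integral_eq_zero_of_decay hG hC'
  have hpt : ∀ s : ℝ, (halfPlaneKernel z s : ℂ) * H s
      = G s + (halfPlaneKernel z s : ℂ) * H z := fun s => by
    have h1 := ofReal_sub_ne_zero hz s
    have h2 : (s : ℂ) - (starRingEnd ℂ) z ≠ 0 := ofReal_sub_conj_ne_zero hz (by simp)
    rw [halfPlaneKernel_complex, hGdef]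
    simp only [dslope_of_ne _ (sub_ne_zero.mp h1), slope, vsub_eq_sub, smul_eq_mul]
    field_simp
    ring
  have hk : Integrable fun s => (halfPlaneKernel z s : ℂ) * H z :=
    (integrable_halfPlaneKernel hz).ofReal.mul_const _
  simp_rw [hpt]
  rw [integral_add hGi hk, hG0, zero_add,
    integral_mul_const, integral_complex_ofReal, integral_halfPlaneKernel hz]

end Contour

section BoundaryValues

/-- Vitali's convergence theorem for exponentials that are bounded in some `L^p`, `p > 1`. -/
lemma tendsto_integral_exp_of_bounded_rpow {α : Type*} [MeasurableSpace α] {ν : Measure α}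
    [IsFiniteMeasure ν] {p D : ℝ} (hp : 1 < p) {Ψ : ℕ → α → ℂ} {L : α → ℂ}
    (hmeas : ∀ n, AEStronglyMeasurable (Ψ n) ν)
    (hInt : ∀ n, Integrable (fun s => Real.exp (p * (Ψ n s).re)) ν)
    (hD : ∀ n, ∫ s, Real.exp (p * (Ψ n s).re) ∂ν ≤ D)
    (hlim : ∀ᵐ s ∂ν, Tendsto (fun n => Ψ n s) atTop (𝓝 (L s))) :
    Integrable (fun s => cexp (L s)) ν ∧
      Tendsto (fun n => ∫ s, cexp (Ψ n s) ∂ν) atTop (𝓝 (∫ s, cexp (L s) ∂ν)) := by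
  have humeas : ∀ n, AEStronglyMeasurable (fun s => cexp (Ψ n s)) ν := fun n =>
    Complex.continuous_exp.comp_aestronglyMeasurable (hmeas n)
  have hulim : ∀ᵐ s ∂ν, Tendsto (fun n => cexp (Ψ n s)) atTop (𝓝 (cexp (L s))) := by
    filter_upwards [hlim] with s hs
    exact (Complex.continuous_exp.tendsto _).comp hs
  have hle : ∀ n s, ‖cexp (Ψ n s)‖ ≤ 1 + Real.exp (p * (Ψ n s).re) := fun n s => by
    rw [norm_exp]
    rcases le_total (Ψ n s).re 0 with h | h
    · have := Real.exp_le_one_iff.mpr h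
      have := Real.exp_pos (p * (Ψ n s).re)
      linarith
    · have : Real.exp (Ψ n s).re ≤ Real.exp (p * (Ψ n s).re) :=
        Real.exp_le_exp.mpr (by nlinarith)
      linarith
  have huint : ∀ n, Integrable (fun s => cexp (Ψ n s)) ν := fun n =>
    ((integrable_const 1).add (hInt n)).mono' (humeas n) (.of_forall (hle n))
  have hLmeas : AEStronglyMeasurable (fun s => cexp (L s)) ν :=
    aestronglyMeasurable_of_tendsto_ae atTop humeas hulim
  have hLint : MemLp (fun s => cexp (L s)) 1 ν := by
    refine ⟨hLmeas, (Lp.eLpNorm_lim_le_liminf_eLpNorm humeas _ hulim).trans_lt ?_⟩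
    refine (liminf_le_of_le (a := ENNReal.ofReal (ν.real univ + D)) (h := fun b hb => ?_)).trans_lt
      ENNReal.ofReal_lt_top
    obtain ⟨n, hn⟩ := hb.exists
    refine hn.trans ?_
    rw [eLpNorm_one_eq_lintegral_enorm, ← ofReal_integral_norm_eq_lintegral_enorm (huint n)]
    refine ENNReal.ofReal_le_ofReal ?_
    calc ∫ s, ‖cexp (Ψ n s)‖ ∂ν ≤ ∫ s, (1 + Real.exp (p * (Ψ n s).re)) ∂ν :=
          integral_mono (huint n).norm ((integrable_const 1).add (hInt n)) (hle n)
      _ ≤ ν.real univ + D := by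
          rw [integral_add (integrable_const 1) (hInt n)]
          simpa using hD n
  refine ⟨memLp_one_iff_integrable.mp hLint, ?_⟩
  refine tendsto_integral_of_L1' _ hLmeas (.of_forall huint) ?_
  refine tendsto_Lp_finite_of_tendsto_ae le_rfl ENNReal.one_ne_top humeas hLint ?_ hulim
  refine unifIntegrable_of le_rfl ENNReal.one_ne_top humeas fun ε hε => ?_
  obtain ⟨c, hc⟩ : ∃ c : ℝ, Real.exp (-((p - 1) * c)) * D ≤ ε := by
    have h1 : Tendsto (fun c : ℝ => Real.exp (-((p - 1) * c)) * D) atTop (𝓝 (0 * D)) :=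
      (Real.tendsto_exp_neg_atTop_nhds_zero.comp
        (tendsto_id.const_mul_atTop (sub_pos.mpr hp))).mul_const D
    rw [zero_mul] at h1
    exact ((h1.eventually (gt_mem_nhds hε)).exists).imp fun _ h => h.le
  refine ⟨(Real.exp c).toNNReal, fun n => ?_⟩
  rw [eLpNorm_one_eq_lintegral_enorm]
  have hI : Integrable (fun s => Real.exp (-((p - 1) * c)) * Real.exp (p * (Ψ n s).re)) ν :=
    (hInt n).const_mul _
  calc _ ≤ ∫⁻ s, ENNReal.ofReal (Real.exp (-((p - 1) * c)) * Real.exp (p * (Ψ n s).re)) ∂ν := by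
        refine lintegral_mono fun s => ?_
        by_cases h : s ∈ {x | (Real.exp c).toNNReal ≤ ‖cexp (Ψ n x)‖₊}
        · rw [indicator_of_mem h, ← ofReal_norm, norm_exp, ← Real.exp_add]
          refine ENNReal.ofReal_le_ofReal (Real.exp_le_exp.mpr ?_)
          have h' : Real.exp c ≤ ‖cexp (Ψ n s)‖ := by
            have h0 := NNReal.coe_le_coe.mpr (show _ ≤ _ from h)
            rwa [Real.coe_toNNReal _ (Real.exp_pos c).le, coe_nnnorm] at h0
          rw [norm_exp, Real.exp_le_exp] at h'
          nlinarith
        · rw [indicator_of_notMem h]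
          simp
    _ = ENNReal.ofReal (∫ s, Real.exp (-((p - 1) * c)) * Real.exp (p * (Ψ n s).re) ∂ν) :=
        (ofReal_integral_eq_lintegral_ofReal hI (.of_forall fun s => by positivity)).symm
    _ ≤ ENNReal.ofReal ε := by
        refine ENNReal.ofReal_le_ofReal ?_
        rw [integral_const_mul]
        exact (mul_le_mul_of_nonneg_left (hD n) (Real.exp_pos _).le).trans hc

lemma ofReal_add_ofReal_mul_I_im (x ε : ℝ) : ((x : ℂ) + ε * I).im = ε := by simp

variable {Φ : ℂ → ℂ} {B a b : ℝ} {z : ℂ}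

lemma differentiableOn_exp_comp_add (hΦ : DifferentiableOn ℂ Φ {w | 0 < w.im}) {ε : ℝ}
    (hε : 0 < ε) (c d : ℂ) :
    DifferentiableOn ℂ (fun w => cexp (c * Φ (w + ε * I) + d)) {w | 0 ≤ w.im} := by
  have : DifferentiableOn ℂ (fun w => Φ (w + ε * I)) {w | 0 ≤ w.im} :=
    hΦ.comp (by fun_prop) fun w (hw : 0 ≤ w.im) => by
      have : 0 < w.im + ε := by linarith
      simpa using this
  exact ((this.const_mul c).add_const d).cexp

lemma norm_exp_comp_add_le (hB : ∀ w : ℂ, 0 < w.im → ‖Φ w‖ ≤ B / w.im) {ε : ℝ} (hε : 0 < ε)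
    (c d : ℂ) (w : ℂ) (hw : 0 ≤ w.im) :
    ‖cexp (c * Φ (w + ε * I) + d)‖ ≤ Real.exp (‖c‖ * (B / ε) + ‖d‖) := by
  have him : (w + ε * I).im = w.im + ε := by simp
  have h := hB (w + ε * I) (by rw [him]; linarith)
  rw [him] at h
  have hB0 : 0 ≤ B := by
    have h0 := (norm_nonneg _).trans (hB I (by simp))
    simpa using h0
  have h2 : B / (w.im + ε) ≤ B / ε := div_le_div_of_nonneg_left hB0 hε (by linarith)
  rw [norm_exp]
  refine Real.exp_le_exp.mpr ((re_le_norm _).trans ((norm_add_le _ _).trans ?_))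
  rw [norm_mul]
  gcongr
  exact h.trans h2

lemma integrable_halfPlaneKernel_mul_exp (hz : 0 < z.im)
    (hΦ : DifferentiableOn ℂ Φ {w | 0 < w.im})
    (hB : ∀ w : ℂ, 0 < w.im → ‖Φ w‖ ≤ B / w.im) {ε : ℝ} (hε : 0 < ε) (c d : ℂ) :
    Integrable fun s : ℝ => (halfPlaneKernel z s : ℂ) * cexp (c * Φ (s + ε * I) + d) := by
  refine (integrable_halfPlaneKernel hz).ofReal.mul_bdd (c := Real.exp (‖c‖ * (B / ε) + ‖d‖))
    ?_ (.of_forall fun s => norm_exp_comp_add_le hB hε c d s (by simp))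
  exact ((differentiableOn_exp_comp_add hΦ hε c d).continuousOn.comp_continuous continuous_ofReal
    fun x => by simp).aestronglyMeasurable

/-- A uniform `L^p` bound on horizontal lines for the exponential of a function whose imaginary
part takes values in an interval of length less than `π / p`. -/
lemma integral_halfPlaneKernel_mul_exp_re_le {p : ℝ} (hp : 0 < p) (hpab : p * (b - a) < π)
    (hz : 0 < z.im) (hΦ : DifferentiableOn ℂ Φ {w | 0 < w.im})
    (hB : ∀ w : ℂ, 0 < w.im → ‖Φ w‖ ≤ B / w.im)
    (him : ∀ w : ℂ, 0 < w.im → (Φ w).im ∈ Set.Icc a b) {ε : ℝ} (hε : 0 < ε) :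
    Integrable (fun s : ℝ => halfPlaneKernel z s * Real.exp (p * (Φ (s + ε * I)).re)) ∧
    ∫ s : ℝ, halfPlaneKernel z s * Real.exp (p * (Φ (s + ε * I)).re)
      ≤ π * Real.exp (p * (B / z.im)) / Real.cos (p * (b - a) / 2) := by
  have hab : a ≤ b := nonempty_Icc.mp ⟨_, him I (by simp)⟩
  have hcos : 0 < Real.cos (p * (b - a) / 2) := by
    refine Real.cos_pos_of_mem_Ioo ⟨?_, by linarith⟩
    have : 0 ≤ p * (b - a) := mul_nonneg hp.le (by linarith)
    linarith [Real.pi_pos]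
  set d : ℂ := -((p * ((a + b) / 2) : ℝ) : ℂ) * I with hd
  have hInt := integrable_halfPlaneKernel_mul_exp hz hΦ hB hε p d
  have hint0 : Integrable
      (fun s : ℝ => halfPlaneKernel z s * Real.exp (p * (Φ (s + ε * I)).re)) := by
    refine (integrable_halfPlaneKernel_mul_exp hz hΦ hB hε p 0).norm.congr
      (.of_forall fun s => ?_)
    simp [norm_exp, abs_of_pos (halfPlaneKernel_pos hz s)]
  refine ⟨hint0, ?_⟩
  have hP := congrArg Complex.re <| integral_halfPlaneKernel_mul hz
    (differentiableOn_exp_comp_add hΦ hε p d) (norm_exp_comp_add_le hB hε p d)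
  have hre : ∀ w : ℂ, (cexp (p * Φ w + d)).re
      = Real.exp (p * (Φ w).re) * Real.cos (p * ((Φ w).im - (a + b) / 2)) := fun w => by
    rw [exp_re, hd]
    congr 2 <;> simp
    ring
  rw [← RCLike.re_eq_complex_re, ← integral_re hInt] at hP
  simp only [RCLike.re_eq_complex_re, re_ofReal_mul, hre] at hP
  rw [le_div_iff₀ hcos, ← integral_mul_const]
  calc _ ≤ ∫ s : ℝ, halfPlaneKernel z s * (Real.exp (p * (Φ (s + ε * I)).re) *
          Real.cos (p * ((Φ (s + ε * I)).im - (a + b) / 2))) := by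
        refine integral_mono (hint0.mul_const _) ?_ fun s => ?_
        · refine hInt.re.congr (.of_forall fun s => ?_)
          simp only [RCLike.re_eq_complex_re, re_ofReal_mul, hre]
        · simp only [mul_assoc]
          refine mul_le_mul_of_nonneg_left (mul_le_mul_of_nonneg_left ?_ (Real.exp_pos _).le)
            (halfPlaneKernel_pos hz s).le
          obtain ⟨h1, h2⟩ := him (s + ε * I) (by simpa using hε)
          rw [← Real.cos_abs (p * ((Φ (s + ε * I)).im - (a + b) / 2))]
          refine Real.cos_le_cos_of_nonneg_of_le_pi (abs_nonneg _)
            (by nlinarith) ?_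
          rw [abs_mul, abs_of_pos hp, mul_div_assoc]
          refine mul_le_mul_of_nonneg_left ?_ hp.le
          rw [abs_le]
          constructor <;> linarith
    _ = π * (Real.exp (p * (Φ (z + ε * I)).re) *
          Real.cos (p * ((Φ (z + ε * I)).im - (a + b) / 2))) := hP
    _ ≤ π * (Real.exp (p * (B / z.im)) * 1) := by
        have him' : (z + ε * I).im = z.im + ε := by simp
        have h := hB (z + ε * I) (by rw [him']; linarith)
        rw [him'] at h
        have hB0 : 0 ≤ B := by
          have h0 := (norm_nonneg _).trans (hB I (by simp))
          simpa using h0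
        have h2 : B / (z.im + ε) ≤ B / z.im := div_le_div_of_nonneg_left hB0 hz (by linarith)
        refine mul_le_mul_of_nonneg_left ?_ Real.pi_pos.le
        refine (mul_le_mul_of_nonneg_left (Real.cos_le_one _) (Real.exp_pos _).le).trans ?_
        gcongr
        exact (re_le_norm _).trans (h.trans h2)
    _ = _ := by ring

/-- The Poisson formula for the exponential of a function with imaginary part in an interval of
length less than `π`, in terms of its boundary values. -/
lemma integral_halfPlaneKernel_mul_exp_boundary (hab : b - a < π)
    (hΦ : DifferentiableOn ℂ Φ {w | 0 < w.im})
    (hB : ∀ w : ℂ, 0 < w.im → ‖Φ w‖ ≤ B / w.im)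
    (him : ∀ w : ℂ, 0 < w.im → (Φ w).im ∈ Set.Icc a b) {L : ℝ → ℂ}
    (hL : ∀ᵐ x : ℝ, Tendsto (fun ε : ℝ => Φ (x + ε * I)) (𝓝[>] 0) (𝓝 (L x))) (hz : 0 < z.im) :
    Integrable (fun s : ℝ => (halfPlaneKernel z s : ℂ) * cexp (L s)) ∧
      ∫ s : ℝ, (halfPlaneKernel z s : ℂ) * cexp (L s) = π * cexp (Φ z) := by
  have hπ := Real.pi_pos
  obtain ⟨p, hp, hpab⟩ : ∃ p : ℝ, 1 < p ∧ p * (b - a) < π := by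
    have h : Tendsto (fun p : ℝ => p * (b - a)) (𝓝[>] 1) (𝓝 (1 * (b - a))) :=
      (tendsto_id.mul_const _).mono_left nhdsWithin_le_nhds
    obtain ⟨p, h1, h2⟩ := ((h.eventually (gt_mem_nhds (by simpa using hab))).and
      self_mem_nhdsWithin).exists
    exact ⟨p, h2, h1⟩
  have hkm : Measurable fun s => (halfPlaneKernel z s).toNNReal :=
    (continuous_halfPlaneKernel hz).measurable.real_toNNReal
  have hsmul : ∀ {E : Type} [NormedAddCommGroup E] [NormedSpace ℝ E] (s : ℝ) (v : E),
      (halfPlaneKernel z s).toNNReal • v = halfPlaneKernel z s • v := fun s v => by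
    rw [NNReal.smul_def, Real.coe_toNNReal _ (halfPlaneKernel_pos hz s).le]
  set ν : Measure ℝ := volume.withDensity fun s => ((halfPlaneKernel z s).toNNReal : ℝ≥0∞) with hν
  have : IsFiniteMeasure ν :=
    isFiniteMeasure_withDensity_ofReal (integrable_halfPlaneKernel hz).hasFiniteIntegral
  have hac : ν ≪ volume := withDensity_absolutelyContinuous _ _
  have hεpos : ∀ n : ℕ, (0 : ℝ) < 1 / ((n : ℝ) + 1) := fun n => Nat.one_div_pos_of_nat
  have hεlim : Tendsto (fun n : ℕ => 1 / ((n : ℝ) + 1)) atTop (𝓝[>] 0) :=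
    tendsto_nhdsWithin_iff.mpr
      ⟨tendsto_one_div_add_atTop_nhds_zero_nat, .of_forall fun n => hεpos n⟩
  have hcont : ∀ n : ℕ, Continuous fun s : ℝ => Φ (s + (1 / ((n : ℝ) + 1) : ℝ) * I) := fun n =>
    hΦ.continuousOn.comp_continuous (by fun_prop) fun s => by
      simpa only [mem_ofPred_eq, ofReal_add_ofReal_mul_I_im] using hεpos n
  have hLp := fun n => integral_halfPlaneKernel_mul_exp_re_le (zero_lt_one.trans hp) hpab hz hΦ hB
    him (hεpos n)
  obtain ⟨hi, hlim⟩ := tendsto_integral_exp_of_bounded_rpow (ν := ν) hp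
    (Ψ := fun n s => Φ (s + (1 / ((n : ℝ) + 1) : ℝ) * I)) (L := L)
    (D := π * Real.exp (p * (B / z.im)) / Real.cos (p * (b - a) / 2))
    (fun n => (hcont n).aestronglyMeasurable)
    (fun n => by
      rw [hν, integrable_withDensity_iff_integrable_smul hkm]
      simpa only [hsmul, smul_eq_mul] using (hLp n).1)
    (fun n => by
      rw [hν, integral_withDensity_eq_integral_smul hkm]
      simpa only [hsmul, smul_eq_mul] using (hLp n).2)
    (hac.ae_le <| by
      filter_upwards [hL] with x hx using hx.comp hεlim)
  rw [hν, integrable_withDensity_iff_integrable_smul hkm] at hi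
  simp only [hν, integral_withDensity_eq_integral_smul hkm] at hlim
  simp only [hsmul, real_smul] at hi hlim
  refine ⟨hi, tendsto_nhds_unique hlim ?_⟩
  have hP : ∀ n : ℕ, ∫ s : ℝ, (halfPlaneKernel z s : ℂ) *
      cexp (Φ (s + (1 / ((n : ℝ) + 1) : ℝ) * I))
        = π * cexp (Φ (z + (1 / ((n : ℝ) + 1) : ℝ) * I)) := fun n => by
    simpa only [one_mul, add_zero] using integral_halfPlaneKernel_mul hz
      (differentiableOn_exp_comp_add hΦ (hεpos n) 1 0) (norm_exp_comp_add_le hB (hεpos n) 1 0)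
  simp_rw [hP]
  have hΦz : ContinuousAt Φ z := hΦ.continuousOn.continuousAt
    ((isOpen_lt continuous_const Complex.continuous_im).mem_nhds hz)
  have hz' : Tendsto (fun n : ℕ => z + (1 / ((n : ℝ) + 1) : ℝ) * I) atTop (𝓝 z) := by
    have h : Tendsto (fun ε : ℝ => z + ε * I) (𝓝[>] 0) (𝓝 (z + (0 : ℝ) * I)) :=
      (Continuous.tendsto (by fun_prop) 0).mono_left nhdsWithin_le_nhds
    rw [ofReal_zero, zero_mul, add_zero] at h
    exact h.comp hεlim
  exact ((Complex.continuous_exp.continuousAt.tendsto.comp (hΦz.tendsto.comp hz')).const_mul _)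

end BoundaryValues

section PrincipalValue

lemma Complex.log_ofReal_of_neg {x : ℝ} (hx : x < 0) :
    Complex.log (x : ℂ) = (Real.log (-x) : ℂ) + π * I := by
  rw [Complex.log, arg_ofReal_of_neg hx, norm_real, Real.norm_eq_abs, abs_of_neg hx]

lemma tendsto_log_add_mul_I {x : ℝ} (hx : x ≠ 0) :
    Tendsto (fun ε : ℝ => Complex.log (x + ε * I)) (𝓝[>] 0) (𝓝 (Complex.log x)) := by
  have h : Tendsto (fun ε : ℝ => (x + ε * I : ℂ)) (𝓝[>] 0) (𝓝 x) := by
    have h : Tendsto (fun ε : ℝ => (x + ε * I : ℂ)) (𝓝[>] 0) (𝓝 (x + (0 : ℝ) * I)) :=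
      (Continuous.tendsto (by fun_prop) 0).mono_left nhdsWithin_le_nhds
    simpa using h
  rcases lt_or_gt_of_ne hx with h0 | h0
  · have h1 : Tendsto (fun ε : ℝ => (x + ε * I : ℂ)) (𝓝[>] 0) (𝓝[{w : ℂ | 0 ≤ w.im}] x) := by
      refine tendsto_nhdsWithin_iff.mpr ⟨h, ?_⟩
      filter_upwards [self_mem_nhdsWithin] with ε hε
      simpa using (mem_Ioi.mp hε).le
    have h2 := tendsto_log_nhdsWithin_im_nonneg_of_re_neg_of_im_zero (z := (x : ℂ))
      (by simpa using h0) (by simp)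
    rw [norm_real, Real.norm_eq_abs, abs_of_neg h0, ← Complex.log_ofReal_of_neg h0] at h2
    exact h2.comp h1
  · exact h.clog (ofReal_mem_slitPlane.mpr h0)

lemma integral_one_div_ofReal_sub {z : ℂ} (hz : 0 < z.im) (a b : ℝ) :
    ∫ s : ℝ in a..b, 1 / ((s : ℂ) - z) = Complex.log (z - b) - Complex.log (z - a) := by
  have hcont : Continuous fun s : ℝ => 1 / ((s : ℂ) - z) := by
    simpa only [one_div] using continuous_inv_ofReal_sub hz
  refine intervalIntegral.integral_eq_sub_of_hasDerivAt
    (f := fun s : ℝ => Complex.log (z - s)) (fun s _ => ?_) (hcont.intervalIntegrable a b)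
  have hmem : z - (s : ℂ) ∈ slitPlane := Or.inr (by simpa using hz.ne')
  have h := (((hasDerivAt_id s).ofReal_comp).const_sub z).clog_real hmem
  refine h.congr_deriv ?_
  rw [← neg_sub z (s : ℂ), div_neg, neg_div]
  simp

lemma tendsto_integral_one_div_ofReal_sub {x a b : ℝ} (ha : x ≠ a) (hb : x ≠ b) :
    Tendsto (fun ε : ℝ => ∫ s : ℝ in a..b, 1 / ((s : ℂ) - (x + ε * I))) (𝓝[>] 0)
      (𝓝 (Complex.log ((x - b : ℝ) : ℂ) - Complex.log ((x - a : ℝ) : ℂ))) := by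
  refine ((tendsto_log_add_mul_I (sub_ne_zero.mpr hb)).sub
    (tendsto_log_add_mul_I (sub_ne_zero.mpr ha))).congr' ?_
  filter_upwards [self_mem_nhdsWithin] with ε hε
  rw [integral_one_div_ofReal_sub (by simpa using hε)]
  congr 2 <;> push_cast <;> ring

lemma tendsto_setIntegral_Icc_one_div_ofReal_sub {x δ : ℝ} (hδ : 0 < δ) :
    Tendsto (fun ε : ℝ => ∫ s : ℝ in Set.Icc (x - δ) (x + δ), 1 / ((s : ℂ) - (x + ε * I)))
      (𝓝[>] 0) (𝓝 (π * I)) := by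
  have h := tendsto_integral_one_div_ofReal_sub (x := x) (a := x - δ) (b := x + δ)
    (by linarith) (by linarith)
  have e1 : x - (x + δ) = -δ := by ring
  have e2 : x - (x - δ) = δ := by ring
  rw [e1, e2, Complex.log_ofReal_of_neg (neg_neg_of_pos hδ), neg_neg, ← ofReal_log hδ.le,
    add_sub_cancel_left] at h
  refine h.congr fun ε => ?_
  rw [integral_Icc_eq_integral_Ioc, intervalIntegral.integral_of_le (by linarith)]

lemma integral_indicator_one_div_sub_eq_zero (x δ ε : ℝ) :
    ∫ s in {s : ℝ | ε < |x - s|}, (Set.Icc (x - δ) (x + δ)).indicator (fun s => 1 / (s - x)) s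
      = 0 := by
  have hT : MeasurableSet {s : ℝ | ε < |x - s|} :=
    (isOpen_lt continuous_const (by fun_prop)).measurableSet
  rw [← integral_indicator hT]
  set F : ℝ → ℝ := {s : ℝ | ε < |x - s|}.indicator
    ((Set.Icc (x - δ) (x + δ)).indicator (fun s => 1 / (s - x))) with hF
  have hodd : ∀ s, F (2 * x - s) = -F s := fun s => by
    have h1 : 2 * x - s ∈ {s : ℝ | ε < |x - s|} ↔ s ∈ {s : ℝ | ε < |x - s|} := by
      rw [mem_ofPred_eq, mem_ofPred_eq, show x - (2 * x - s) = -(x - s) by ring, abs_neg]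
    have h2 : 2 * x - s ∈ Set.Icc (x - δ) (x + δ) ↔ s ∈ Set.Icc (x - δ) (x + δ) := by
      constructor <;> rintro ⟨h, h'⟩ <;> constructor <;> linarith
    simp only [hF, indicator_apply, h1, h2]
    split_ifs
    · rw [show 2 * x - s - x = -(s - x) by ring, div_neg]
    · simp
    · simp
  have h := integral_sub_left_eq_self F volume (2 * x)
  simp_rw [hodd, integral_neg] at h
  linarith

/-- The quotient whose integral is the principal value integral of `θ s / (s - x)`. -/
noncomputable def regularizedQuotient (θ : ℝ → ℝ) (x δ s : ℝ) : ℝ :=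
  (θ s - (Set.Icc (x - δ) (x + δ)).indicator (fun _ => θ x) s) / (s - x)

variable {θ : ℝ → ℝ} {x δ K : ℝ}

lemma regularizedQuotient_mul (hδ : 0 < δ) (s : ℝ) :
    regularizedQuotient θ x δ s * (s - x)
      = θ s - (Set.Icc (x - δ) (x + δ)).indicator (fun _ => θ x) s := by
  rcases eq_or_ne s x with rfl | h
  · rw [indicator_of_mem (show s ∈ Set.Icc (s - δ) (s + δ) from ⟨by linarith, by linarith⟩)]
    simp
  · exact div_mul_cancel₀ _ (sub_ne_zero.mpr h)

lemma integrable_regularizedQuotient (hθ : Integrable θ) (hδ : 0 < δ)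
    (hK : ∀ s, |s - x| ≤ δ → |θ s - θ x| ≤ K * |s - x|) :
    Integrable (regularizedQuotient θ x δ) := by
  have hbd : Integrable fun s =>
      (Set.Icc (x - δ) (x + δ)).indicator (fun _ => |K|) s + |θ s| / δ := by
    refine Integrable.add ?_ (hθ.abs.div_const δ)
    rw [integrable_indicator_iff measurableSet_Icc]
    exact integrableOn_const (by simp)
  refine hbd.mono' ?_ (.of_forall fun s => ?_)
  · refine AEMeasurable.aestronglyMeasurable ?_
    exact (hθ.aemeasurable.sub
      (measurable_const.indicator measurableSet_Icc).aemeasurable).div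
        (by fun_prop)
  · rw [regularizedQuotient, Real.norm_eq_abs, abs_div]
    by_cases hs : s ∈ Set.Icc (x - δ) (x + δ)
    · rw [indicator_of_mem hs, indicator_of_mem hs]
      have hsx : |s - x| ≤ δ := abs_le.mpr ⟨by linarith [hs.1], by linarith [hs.2]⟩
      have h1 : |θ s - θ x| / |s - x| ≤ |K| :=
        div_le_of_le_mul₀ (abs_nonneg _) (abs_nonneg _)
          ((hK s hsx).trans (mul_le_mul_of_nonneg_right (le_abs_self K) (abs_nonneg _)))
      have h2 : 0 ≤ |θ s| / δ := by positivity
      linarith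
    · rw [indicator_of_notMem hs, indicator_of_notMem hs, sub_zero, zero_add]
      have hsx : δ ≤ |s - x| := by
        by_contra! h
        rw [abs_lt] at h
        exact hs ⟨by linarith, by linarith⟩
      gcongr

lemma HT_eq_of_local_lipschitz (hθ : Integrable θ) (hδ : 0 < δ)
    (hK : ∀ s, |s - x| ≤ δ → |θ s - θ x| ≤ K * |s - x|) :
    HT θ x = 1 / π * ∫ s, regularizedQuotient θ x δ s := by
  have hg := integrable_regularizedQuotient hθ hδ hK
  have hT : ∀ ε : ℝ, MeasurableSet {s : ℝ | ε < |x - s|} := fun ε =>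
    (isOpen_lt continuous_const (by fun_prop)).measurableSet
  have hlim : Tendsto (fun ε : ℝ => ∫ s in {s : ℝ | ε < |x - s|}, regularizedQuotient θ x δ s)
      (𝓝[>] 0) (𝓝 (∫ s, regularizedQuotient θ x δ s)) := by
    simp_rw [← integral_indicator (hT _)]
    refine tendsto_integral_filter_of_dominated_convergence
      (fun s => ‖regularizedQuotient θ x δ s‖)
      (.of_forall fun ε => hg.aestronglyMeasurable.indicator (hT ε))
      (.of_forall fun ε => .of_forall fun s => norm_indicator_le_norm_self _ _) hg.norm
      (.of_forall fun s => ?_)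
    rcases eq_or_ne s x with rfl | hs
    · have h0 : regularizedQuotient θ s δ s = 0 := by simp [regularizedQuotient]
      simp [indicator_apply, h0]
    · refine tendsto_const_nhds.congr' ?_
      have hpos : 0 < |x - s| := abs_pos.mpr (sub_ne_zero.mpr hs.symm)
      filter_upwards [nhdsWithin_le_nhds (gt_mem_nhds hpos)] with ε hε
      rw [indicator_of_mem (show s ∈ {s : ℝ | ε < |x - s|} from hε)]
  refine Tendsto.limUnder_eq ((hlim.const_mul (1 / π)).congr' ?_)
  filter_upwards [self_mem_nhdsWithin] with ε hε
  have hε : 0 < ε := hε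
  have hind : IntegrableOn ((Set.Icc (x - δ) (x + δ)).indicator (fun s => 1 / (s - x)))
      {s : ℝ | ε < |x - s|} := by
    have hbd : IntegrableOn ((Set.Icc (x - δ) (x + δ)).indicator (fun _ => 1 / ε))
        {s : ℝ | ε < |x - s|} :=
      ((integrable_indicator_iff measurableSet_Icc).mpr
        (integrableOn_const (by simp))).integrableOn
    refine hbd.mono' ((Measurable.indicator (by fun_prop)
      measurableSet_Icc).aestronglyMeasurable) ?_
    refine (ae_restrict_iff' (hT ε)).mpr (.of_forall fun s hs => ?_)
    have hs : ε < |x - s| := hs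
    by_cases hsA : s ∈ Set.Icc (x - δ) (x + δ)
    · rw [indicator_of_mem hsA, indicator_of_mem hsA, Real.norm_eq_abs, abs_div, abs_one,
        abs_sub_comm s x]
      gcongr
    · simp [indicator_of_notMem hsA]
  have hcongr : ∫ s in {s : ℝ | ε < |x - s|}, θ s / (x - s)
      = ∫ s in {s : ℝ | ε < |x - s|}, (-regularizedQuotient θ x δ s
        - θ x * (Set.Icc (x - δ) (x + δ)).indicator (fun s => 1 / (s - x)) s) := by
    refine setIntegral_congr_fun (hT ε) fun s hs => ?_
    have hs : ε < |x - s| := hs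
    have hne : x - s ≠ 0 := abs_pos.mp (hε.trans hs)
    have hne' : s - x ≠ 0 := by rwa [← neg_sub, neg_ne_zero]
    simp only [regularizedQuotient, indicator_apply]
    rw [← neg_sub s x]
    split_ifs <;> field_simp <;> ring
  have hneg : IntegrableOn (fun s => -regularizedQuotient θ x δ s) {s : ℝ | ε < |x - s|} :=
    hg.neg.integrableOn
  rw [hcongr, integral_sub hneg (hind.const_mul _), integral_neg,
    integral_const_mul, integral_indicator_one_div_sub_eq_zero]
  ring

/-- The Sokhotski–Plemelj formula at a point of local Lipschitz continuity. -/
lemma tendsto_cauchyTransform_boundary (hθ : Integrable θ) (hδ : 0 < δ)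
    (hK : ∀ s, |s - x| ≤ δ → |θ s - θ x| ≤ K * |s - x|) :
    Tendsto (fun ε : ℝ => (1 / (π : ℂ)) * ∫ s, (θ s : ℂ) / ((s : ℂ) - (x + ε * I))) (𝓝[>] 0)
      (𝓝 (HT θ x + θ x * I)) := by
  have hg := integrable_regularizedQuotient hθ hδ hK
  have hlim : Tendsto (fun ε : ℝ => ∫ s, (regularizedQuotient θ x δ s : ℂ) *
      ((s - x : ℝ) / ((s : ℂ) - (x + ε * I)))) (𝓝[>] 0)
      (𝓝 (∫ s, (regularizedQuotient θ x δ s : ℂ))) := by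
    refine tendsto_integral_filter_of_dominated_convergence
      (fun s => ‖regularizedQuotient θ x δ s‖) ?_ ?_ hg.norm (.of_forall fun s => ?_)
    · filter_upwards [self_mem_nhdsWithin] with ε hε
      refine hg.ofReal.aestronglyMeasurable.mul (Continuous.aestronglyMeasurable ?_)
      exact Continuous.div (by fun_prop) (by fun_prop)
        fun s => ofReal_sub_ne_zero (by simpa using hε) s
    · filter_upwards [self_mem_nhdsWithin] with ε hε
      refine .of_forall fun s => ?_
      rw [norm_mul, norm_real]
      refine mul_le_of_le_one_right (norm_nonneg _) ?_
      rw [norm_div, norm_real, Real.norm_eq_abs]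
      refine div_le_one_of_le₀ ?_ (norm_nonneg _)
      simpa using abs_re_le_norm ((s : ℂ) - (x + ε * I))
    · rcases eq_or_ne s x with rfl | hs
      · have h0 : regularizedQuotient θ s δ s = 0 := by simp [regularizedQuotient]
        simp [h0]
      · have hne : (s : ℂ) - x ≠ 0 := sub_ne_zero.mpr (ofReal_injective.ne hs)
        have h : Tendsto (fun ε : ℝ => ((s - x : ℝ) : ℂ) / ((s : ℂ) - (x + ε * I))) (𝓝[>] 0)
            (𝓝 (((s - x : ℝ) : ℂ) / ((s : ℂ) - (x + (0 : ℝ) * I)))) := by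
          refine Tendsto.mono_left (ContinuousAt.tendsto ?_) nhdsWithin_le_nhds
          exact ContinuousAt.div (by fun_prop) (by fun_prop) (by simpa using hne)
        have h1 : ((s - x : ℝ) : ℂ) / ((s : ℂ) - (x + (0 : ℝ) * I)) = 1 := by
          rw [ofReal_zero, zero_mul, add_zero, ofReal_sub, div_self hne]
        rw [h1] at h
        simpa using h.const_mul (regularizedQuotient θ x δ s : ℂ)
  have hsum := (hlim.add
    ((tendsto_setIntegral_Icc_one_div_ofReal_sub (x := x) hδ).const_mul (θ x : ℂ))).const_mul
      (1 / (π : ℂ))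
  have hπ : (π : ℂ) ≠ 0 := by exact_mod_cast Real.pi_ne_zero
  have hval : (1 / (π : ℂ)) * ((∫ s, (regularizedQuotient θ x δ s : ℂ)) + θ x * (π * I))
      = HT θ x + θ x * I := by
    rw [HT_eq_of_local_lipschitz hθ hδ hK, integral_complex_ofReal]
    push_cast
    field_simp
  rw [hval] at hsum
  refine hsum.congr' ?_
  filter_upwards [self_mem_nhdsWithin] with ε hε
  have hz : 0 < (x + ε * I : ℂ).im := by simpa using hε
  have hind : Integrable fun s : ℝ => (θ x : ℂ) *
      (Set.Icc (x - δ) (x + δ)).indicator (fun s : ℝ => 1 / ((s : ℂ) - (x + ε * I))) s := by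
    refine Integrable.const_mul ((integrable_indicator_iff measurableSet_Icc).mpr ?_) _
    simp only [one_div]
    exact (continuous_inv_ofReal_sub hz).continuousOn.integrableOn_Icc
  have hpt : ∀ s : ℝ, (regularizedQuotient θ x δ s : ℂ) * ((s - x : ℝ) / ((s : ℂ) - (x + ε * I)))
      = (θ s : ℂ) / ((s : ℂ) - (x + ε * I)) - (θ x : ℂ) *
        (Set.Icc (x - δ) (x + δ)).indicator (fun s : ℝ => 1 / ((s : ℂ) - (x + ε * I))) s :=
    fun s => by
      rw [← mul_div_assoc, ← ofReal_mul, regularizedQuotient_mul hδ]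
      simp only [indicator_apply]
      split_ifs <;> push_cast <;> ring
  simp_rw [hpt]
  rw [integral_sub (integrable_cauchyTransform hθ hz) hind, integral_const_mul,
    integral_indicator measurableSet_Icc]
  ring

end PrincipalValue

section Representation

/-- The boundary values on the real line of `(1/π) ∫_{-1}^1 (c + θ s) / (s - z) ds`. -/
noncomputable def boundaryExponent (θ : ℝ → ℝ) (c x : ℝ) : ℂ :=
  (c / π : ℝ) * (Complex.log ((x - 1 : ℝ) : ℂ) - Complex.log ((x + 1 : ℝ) : ℂ))
    + (HT θ x + θ x * I)

variable {θ : ℝ → ℝ} {a b c : ℝ} {z : ℂ}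

lemma cauchyTransform_const_add (hθ : Integrable θ) (hsupp : ∀ s ∉ Set.Ioo (-1 : ℝ) 1, θ s = 0)
    (c : ℝ) (hz : 0 < z.im) :
    (1 / (π : ℂ)) * ∫ s in (-1 : ℝ)..1, ((c + θ s : ℝ) : ℂ) / ((s : ℂ) - z)
      = (c / π : ℝ) * (∫ s : ℝ in (-1 : ℝ)..1, 1 / ((s : ℂ) - z))
        + (1 / (π : ℂ)) * ∫ s, (θ s : ℂ) / ((s : ℂ) - z) := by
  have hfull : ∫ s, (θ s : ℂ) / ((s : ℂ) - z) = ∫ s in (-1 : ℝ)..1, (θ s : ℂ) / ((s : ℂ) - z) := by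
    rw [intervalIntegral.integral_of_le (by norm_num)]
    refine (setIntegral_eq_integral_of_forall_compl_eq_zero fun s hs => ?_).symm
    rw [hsupp s fun h => hs (Ioo_subset_Ioc_self h)]
    simp
  have h1 : IntervalIntegrable (fun s : ℝ => (c : ℂ) * (1 / ((s : ℂ) - z))) volume (-1) 1 := by
    simp only [one_div]
    exact ((continuous_inv_ofReal_sub hz).const_mul _).intervalIntegrable _ _
  have h2 : IntervalIntegrable (fun s : ℝ => (θ s : ℂ) / ((s : ℂ) - z)) volume (-1) 1 :=
    (integrable_cauchyTransform hθ hz).intervalIntegrable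
  have hpt : ∀ s : ℝ, ((c + θ s : ℝ) : ℂ) / ((s : ℂ) - z)
      = (c : ℂ) * (1 / ((s : ℂ) - z)) + (θ s : ℂ) / ((s : ℂ) - z) := fun s => by
    push_cast
    ring
  simp_rw [hpt]
  rw [intervalIntegral.integral_add h1 h2, intervalIntegral.integral_const_mul, hfull]
  push_cast
  ring

lemma tendsto_cauchyTransform_const_add (hθ : Integrable θ)
    (hsupp : ∀ s ∉ Set.Ioo (-1 : ℝ) 1, θ s = 0) (c : ℝ) {x δ K : ℝ} (hx : x ≠ 1) (hx' : x ≠ -1)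
    (hδ : 0 < δ) (hK : ∀ s, |s - x| ≤ δ → |θ s - θ x| ≤ K * |s - x|) :
    Tendsto (fun ε : ℝ => (1 / (π : ℂ)) * ∫ s in (-1 : ℝ)..1,
      ((c + θ s : ℝ) : ℂ) / ((s : ℂ) - (x + ε * I))) (𝓝[>] 0) (𝓝 (boundaryExponent θ c x)) := by
  have h := ((tendsto_integral_one_div_ofReal_sub hx' hx).const_mul ((c / π : ℝ) : ℂ)).add
    (tendsto_cauchyTransform_boundary hθ hδ hK)
  rw [sub_neg_eq_add] at h
  refine h.congr' ?_
  filter_upwards [self_mem_nhdsWithin] with ε hε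
  exact (cauchyTransform_const_add hθ hsupp c (by simpa using hε)).symm

lemma integrableOn_const_add (hθ : Integrable θ) (c : ℝ) :
    IntegrableOn (fun s => c + θ s) (Set.Ioc (-1 : ℝ) 1) :=
  (integrableOn_const (by simp)).add hθ.integrableOn

lemma differentiableOn_cauchyTransform_const_add (hθ : Integrable θ) (c : ℝ) :
    DifferentiableOn ℂ (fun z => (1 / (π : ℂ)) * ∫ s in (-1 : ℝ)..1,
      ((c + θ s : ℝ) : ℂ) / ((s : ℂ) - z)) {z | 0 < z.im} := by
  simp_rw [intervalIntegral.integral_of_le (show (-1 : ℝ) ≤ 1 by norm_num)]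
  exact (differentiableOn_cauchyTransform (integrableOn_const_add hθ c)).const_mul _

lemma norm_one_div_pi_mul_intervalIntegral_le {g : ℝ → ℝ}
    (hg : IntegrableOn g (Set.Ioc (-1 : ℝ) 1)) (hz : 0 < z.im) :
    ‖(1 / (π : ℂ)) * ∫ s in (-1 : ℝ)..1, (g s : ℂ) / ((s : ℂ) - z)‖
      ≤ (1 / π * ∫ s in Set.Ioc (-1 : ℝ) 1, |g s|) / z.im := by
  rw [intervalIntegral.integral_of_le (by norm_num), norm_mul, norm_div, norm_one, norm_real,
    Real.norm_of_nonneg Real.pi_pos.le, mul_div_assoc]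
  have := Real.pi_pos
  gcongr
  exact norm_cauchyTransform_le hg hz

lemma integral_halfPlaneKernel_mul_exp_boundaryExponent (hθ : Integrable θ)
    (hsupp : ∀ s ∉ Set.Ioo (-1 : ℝ) 1, θ s = 0)
    (hlip : ∀ᵐ x : ℝ, ∃ δ > 0, ∃ K, ∀ s, |s - x| ≤ δ → |θ s - θ x| ≤ K * |s - x|)
    (ha : a ≤ 0) (hb : 0 ≤ b) (hab : b - a < π) (hθab : ∀ᵐ s, a ≤ c + θ s ∧ c + θ s ≤ b)
    (hz : 0 < z.im) :
    Integrable (fun s : ℝ => (halfPlaneKernel z s : ℂ) * cexp (boundaryExponent θ c s)) ∧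
      ∫ s : ℝ, (halfPlaneKernel z s : ℂ) * cexp (boundaryExponent θ c s)
        = π * cexp ((1 / (π : ℂ)) * ∫ s in (-1 : ℝ)..1, ((c + θ s : ℝ) : ℂ) / ((s : ℂ) - z)) := by
  refine integral_halfPlaneKernel_mul_exp_boundary (a := a) (b := b) hab
    (differentiableOn_cauchyTransform_const_add hθ c)
    (fun w hw => norm_one_div_pi_mul_intervalIntegral_le (integrableOn_const_add hθ c) hw)
    (fun w hw => ?_) ?_ hz
  · rw [intervalIntegral.integral_of_le (by norm_num)]
    exact im_cauchyTransform_mem_Icc (integrableOn_const_add hθ c) ha hb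
      (ae_restrict_of_ae hθab) hw
  · filter_upwards [hlip, volume.ae_ne (1 : ℝ), volume.ae_ne (-1 : ℝ)] with x ⟨δ, hδ, K, hK⟩ h1 h2
    exact tendsto_cauchyTransform_const_add hθ hsupp c h1 h2 hδ hK

/-- If `t` is the jump of the boundary values of `e^{φ⁺} - e^{φ⁻}`, its Cauchy transform
is `e^{φ⁺} - e^{φ⁻}`. -/
lemma cauchyTransform_eq_exp_sub_exp {t : ℝ → ℝ} {M : ℝ} (hθ : Integrable θ)
    (hsupp : ∀ s ∉ Set.Ioo (-1 : ℝ) 1, θ s = 0)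
    (hlip : ∀ᵐ x : ℝ, ∃ δ > 0, ∃ K, ∀ s, |s - x| ≤ δ → |θ s - θ x| ≤ K * |s - x|)
    (hM : ∀ᵐ s, |θ s| ≤ M) (hMπ : M < π / 2) (htsupp : ∀ s ∉ Set.Ioo (-1 : ℝ) 1, t s = 0)
    (ht : ∀ᵐ x, (cexp (boundaryExponent θ (π / 2) x)
      - cexp (boundaryExponent θ (-(π / 2)) x)).im = 2 * π * t x) (hz : 0 < z.im) :
    (1 / (π : ℂ)) * ∫ s in (-1 : ℝ)..1, (t s : ℂ) / ((s : ℂ) - z)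
      = (1 / (2 * (π : ℂ))) *
        (cexp ((1 / (π : ℂ)) * ∫ s in (-1 : ℝ)..1, ((π / 2 + θ s : ℝ) : ℂ) / ((s : ℂ) - z))
        - cexp ((1 / (π : ℂ)) *
          ∫ s in (-1 : ℝ)..1, ((-(π / 2) + θ s : ℝ) : ℂ) / ((s : ℂ) - z))) := by
  have hπ := Real.pi_pos
  have hM0 : 0 ≤ M := by
    obtain ⟨s, hs⟩ := hM.exists
    exact (abs_nonneg _).trans hs
  have hp : ∀ w : ℂ, 0 < w.im → _ := fun w hw =>
    integral_halfPlaneKernel_mul_exp_boundaryExponent (c := π / 2) (a := 0) (b := π / 2 + M) hθ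
      hsupp hlip le_rfl (by linarith) (by linarith)
      (hM.mono fun s hs => by constructor <;> linarith [(abs_le.mp hs).1, (abs_le.mp hs).2]) hw
  have hm : ∀ w : ℂ, 0 < w.im → _ := fun w hw =>
    integral_halfPlaneKernel_mul_exp_boundaryExponent (c := -(π / 2)) (a := -(π / 2 + M)) (b := 0)
      hθ hsupp hlip (by linarith) le_rfl (by linarith)
      (hM.mono fun s hs => by constructor <;> linarith [(abs_le.mp hs).1, (abs_le.mp hs).2]) hw
  set Φ : ℝ → ℂ → ℂ := fun c w =>
    (1 / (π : ℂ)) * ∫ s in (-1 : ℝ)..1, ((c + θ s : ℝ) : ℂ) / ((s : ℂ) - w) with hΦ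
  have hker : ∀ w : ℂ, 0 < w.im → Integrable (fun s => t s * halfPlaneKernel w s) ∧
      ∫ s, t s * halfPlaneKernel w s
        = 1 / 2 * (cexp (Φ (π / 2) w) - cexp (Φ (-(π / 2)) w)).im := fun w hw => by
    obtain ⟨hpi, hpe⟩ := hp w hw
    obtain ⟨hmi, hme⟩ := hm w hw
    have hJ := (hpi.sub hmi).im
    have hcongr : (fun s => RCLike.im (((fun s : ℝ => (halfPlaneKernel w s : ℂ) *
          cexp (boundaryExponent θ (π / 2) s)) - fun s : ℝ => (halfPlaneKernel w s : ℂ) *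
          cexp (boundaryExponent θ (-(π / 2)) s)) s))
        =ᵐ[volume] fun s => 2 * π * (t s * halfPlaneKernel w s) := by
      filter_upwards [ht] with s hs
      rw [Pi.sub_apply, ← mul_sub, RCLike.im_eq_complex_im, im_ofReal_mul, hs]
      ring
    have hInt : Integrable (fun s => t s * halfPlaneKernel w s) := by
      refine ((hJ.congr hcongr).const_mul (2 * π)⁻¹).congr (.of_forall fun s => ?_)
      field_simp
    refine ⟨hInt, ?_⟩
    have h1 := integral_im (hpi.sub hmi)
    rw [integral_congr_ae hcongr, integral_const_mul, integral_sub' hpi hmi, hpe, hme, ← mul_sub,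
      RCLike.im_eq_complex_im, im_ofReal_mul] at h1
    have h2 : π * (2 * ∫ s, t s * halfPlaneKernel w s)
        = π * (cexp (Φ (π / 2) w) - cexp (Φ (-(π / 2)) w)).im := by
      rw [← h1]
      ring
    have h3 := mul_left_cancel₀ hπ.ne' h2
    linarith
  have htint : IntegrableOn t (Set.Ioc (-1 : ℝ) 1) := by
    have h : IntegrableOn (fun s => t s * halfPlaneKernel I s) (Set.Icc (-1 : ℝ) 1) :=
      (hker I (by simp)).1.integrableOn
    have hk : ContinuousOn (fun s => (halfPlaneKernel I s)⁻¹) (Set.Icc (-1 : ℝ) 1) :=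
      ((continuous_halfPlaneKernel (z := I) (by simp)).inv₀
        fun s => (halfPlaneKernel_pos (by simp) s).ne').continuousOn
    have h' : IntegrableOn t (Set.Icc (-1 : ℝ) 1) :=
      (h.mul_continuousOn hk isCompact_Icc).congr (.of_forall fun s =>
        mul_inv_cancel_right₀ (halfPlaneKernel_pos (by simp) s).ne' _)
    exact h'.mono_set Ioc_subset_Icc_self
  set F : ℂ → ℂ := fun w => (1 / (2 * (π : ℂ))) * (cexp (Φ (π / 2) w) - cexp (Φ (-(π / 2)) w))
    with hF
  set T : ℂ → ℂ := fun w => (1 / (π : ℂ)) * ∫ s in (-1 : ℝ)..1, (t s : ℂ) / ((s : ℂ) - w) with hT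
  have hopen : IsOpen {w : ℂ | 0 < w.im} := isOpen_lt continuous_const Complex.continuous_im
  have hTd : DifferentiableOn ℂ T {w | 0 < w.im} := by
    simp_rw [hT, intervalIntegral.integral_of_le (show (-1 : ℝ) ≤ 1 by norm_num)]
    exact (differentiableOn_cauchyTransform htint).const_mul _
  have hFd : DifferentiableOn ℂ F {w | 0 < w.im} :=
    ((differentiableOn_cauchyTransform_const_add hθ _).cexp.sub
      (differentiableOn_cauchyTransform_const_add hθ _).cexp).const_mul _
  have him : ∀ w ∈ {w : ℂ | 0 < w.im}, (T w - F w).im = 0 := fun w hw => by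
    have hTim : (T w).im = 1 / π * ∫ s, t s * halfPlaneKernel w s := by
      have hcast : (1 / (π : ℂ)) = ((1 / π : ℝ) : ℂ) := by push_cast; rfl
      simp only [hT]
      rw [hcast, im_ofReal_mul, intervalIntegral.integral_of_le (by norm_num),
        im_cauchyTransform htint hw]
      congr 1
      refine setIntegral_eq_integral_of_forall_compl_eq_zero fun s hs => ?_
      rw [htsupp s fun h => hs (Ioo_subset_Ioc_self h), zero_mul]
    have hFim : (F w).im = 1 / (2 * π) * (cexp (Φ (π / 2) w) - cexp (Φ (-(π / 2)) w)).im := by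
      have hcast : (1 / (2 * (π : ℂ))) = ((1 / (2 * π) : ℝ) : ℂ) := by push_cast; rfl
      simp only [hF]
      rw [hcast, im_ofReal_mul]
    rw [sub_im, hTim, hFim, (hker w hw).2]
    field_simp
    ring
  obtain ⟨k, hk⟩ := AnalyticOnNhd.eq_const_of_im_eq_const ((hTd.sub hFd).analyticOnNhd hopen) him
    hopen ⟨⟨I, by simp⟩, (convex_halfSpace_im_gt 0).isPreconnected⟩
  have hdecay : ∀ g : ℝ → ℝ, IntegrableOn g (Set.Ioc (-1 : ℝ) 1) →
      Tendsto (fun y : ℝ => (1 / (π : ℂ)) *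
        ∫ s in (-1 : ℝ)..1, (g s : ℂ) / ((s : ℂ) - (y * I))) atTop (𝓝 0) := fun g hg => by
    refine squeeze_zero_norm' (a := fun y => (1 / π * ∫ s in Set.Ioc (-1 : ℝ) 1, |g s|) / y) ?_
      (tendsto_const_nhds.div_atTop tendsto_id)
    filter_upwards [eventually_gt_atTop 0] with y hy
    simpa using norm_one_div_pi_mul_intervalIntegral_le (z := y * I) hg (by simpa using hy)
  have hlim : Tendsto (fun y : ℝ => T (y * I) - F (y * I)) atTop (𝓝 0) := by
    have h1 := (Complex.continuous_exp.tendsto 0).comp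
      (hdecay _ (integrableOn_const_add hθ (π / 2)))
    have h2 := (Complex.continuous_exp.tendsto 0).comp
      (hdecay _ (integrableOn_const_add hθ (-(π / 2))))
    have h3 := (hdecay t htint).sub ((h1.sub h2).const_mul (1 / (2 * (π : ℂ))))
    simp only [sub_self, mul_zero] at h3
    exact h3
  have hk0 : k = 0 := by
    refine tendsto_nhds_unique (tendsto_const_nhds.congr' ?_) hlim
    filter_upwards [eventually_gt_atTop 0] with y hy
    exact (hk _ (by simpa using hy)).symm
  have := hk z hz
  rw [hk0] at this
  exact sub_eq_zero.mp this

end Representation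


lemma exists_mem_Ioo_of_notMem_nodes {y : ℕ → ℝ} {x : ℝ} {k : ℕ} (h0 : y 0 < x) (hk : x < y k)
    (hx : ∀ j ≤ k, x ≠ y j) : ∃ j < k, x ∈ Set.Ioo (y j) (y (j + 1)) := by
  induction k with
  | zero => exact absurd hk h0.not_gt
  | succ k ih =>
    rcases lt_or_gt_of_ne (hx k k.le_succ) with h | h
    · obtain ⟨j, hj, hxj⟩ := ih h fun j hj => hx j (hj.trans k.le_succ)
      exact ⟨j, hj.trans k.lt_succ_self, hxj⟩
    · exact ⟨k, k.lt_succ_self, h, hk⟩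

lemma LipschitzOnWith.exists_abs_le_Ioo {f : ℝ → ℝ} {K : NNReal} {a b : ℝ}
    (hf : LipschitzOnWith K f (Set.Ioo a b)) : ∃ B, ∀ x ∈ Set.Ioo a b, |f x| ≤ B := by
  rcases (Set.Ioo a b).eq_empty_or_nonempty with h | ⟨c, hc⟩
  · exact ⟨0, fun x hx => by simp [h] at hx⟩
  · refine ⟨|f c| + K * (b - a), fun x hx => ?_⟩
    have h1 := hf.dist_le_mul x hx c hc
    rw [Real.dist_eq, Real.dist_eq] at h1
    have h2 : |x - c| ≤ b - a := by
      rw [abs_le]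
      constructor <;> linarith [hx.1, hx.2, hc.1, hc.2]
    have h3 : |f x| - |f c| ≤ |f x - f c| := abs_sub_abs_le_abs_sub _ _
    nlinarith [mul_le_mul_of_nonneg_left h2 K.coe_nonneg]

lemma PiecewiseLipschitzOn.exists_finite {f : ℝ → ℝ} (hf : PiecewiseLipschitzOn f)
    (hf0 : ∀ x, x ∉ Set.Ioo (-1 : ℝ) 1 → f x = 0) :
    ∃ N : Set ℝ, N.Finite ∧ ∃ B, ∀ x ∉ N, |f x| ≤ B ∧
      ∃ δ > 0, ∃ K, ∀ s, |s - x| ≤ δ → |f s - f x| ≤ K * |s - x| := by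
  obtain ⟨m, y, hm, hy0, hym, -, hlip⟩ := hf
  have hbdd : ∀ j, ∃ B, j < m → ∀ x ∈ Set.Ioo (y j) (y (j + 1)), |f x| ≤ B := fun j => by
    by_cases hj : j < m
    · obtain ⟨K, hK⟩ := hlip j hj
      obtain ⟨B, hB⟩ := hK.exists_abs_le_Ioo
      exact ⟨B, fun _ => hB⟩
    · exact ⟨0, fun h => absurd h hj⟩
  choose B hB using hbdd
  refine ⟨y '' Set.Iic m, (Set.finite_Iic m).image y, ∑ j ∈ Finset.range m, |B j|,
    fun x hx => ?_⟩
  have hx' : ∀ j ≤ m, x ≠ y j := fun j hj h => hx ⟨j, hj, h.symm⟩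
  have hpiece : ∀ U : Set ℝ, IsOpen U → x ∈ U → ∀ K : NNReal, LipschitzOnWith K f U →
      ∃ δ > 0, ∃ K, ∀ s, |s - x| ≤ δ → |f s - f x| ≤ K * |s - x| := fun U hU hxU K hK => by
    obtain ⟨δ, hδ, hball⟩ := Metric.nhds_basis_closedBall.mem_iff.1 (hU.mem_nhds hxU)
    exact ⟨δ, hδ, K, fun s hs => hK.dist_le_mul s (hball (by simpa [Real.dist_eq] using hs)) x hxU⟩
  by_cases hin : x ∈ Set.Ioo (-1 : ℝ) 1
  · obtain ⟨j, hj, hxj⟩ := exists_mem_Ioo_of_notMem_nodes (hy0 ▸ hin.1) (hym ▸ hin.2) hx'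
    obtain ⟨K, hK⟩ := hlip j hj
    refine ⟨((hB j hj x hxj).trans (le_abs_self _)).trans ?_, hpiece _ isOpen_Ioo hxj K hK⟩
    exact Finset.single_le_sum (f := fun j => |B j|) (fun _ _ => abs_nonneg _)
      (Finset.mem_range.2 hj)
  · refine ⟨?_, hpiece (Set.Icc (-1 : ℝ) 1)ᶜ isClosed_Icc.isOpen_compl (fun h => hin ?_) 0 ?_⟩
    · rw [hf0 x hin, abs_zero]
      exact Finset.sum_nonneg fun _ _ => abs_nonneg _
    · exact ⟨lt_of_le_of_ne h.1 (hy0 ▸ (hx' 0 m.zero_le).symm),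
        lt_of_le_of_ne h.2 (hym ▸ hx' m le_rfl)⟩
    · refine LipschitzOnWith.of_dist_le_mul fun a ha b hb => ?_
      rw [hf0 a fun h => ha (Ioo_subset_Icc_self h), hf0 b fun h => hb (Ioo_subset_Icc_self h)]
      simp

lemma Real.abs_arctan_sub_arctan_le (a b : ℝ) : |Real.arctan a - Real.arctan b| ≤ |a - b| := by
  have h : LipschitzWith 1 Real.arctan := by
    refine lipschitzWith_of_nnnorm_deriv_le Real.differentiable_arctan fun x => ?_
    rw [← NNReal.coe_le_coe, coe_nnnorm, Real.deriv_arctan, Real.norm_eq_abs,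
      abs_of_pos (by positivity), NNReal.coe_one, div_le_one (by positivity)]
    nlinarith [sq_nonneg x]
  simpa [Real.dist_eq] using h.dist_le_mul a b

lemma Real.abs_arctan_le {a b : ℝ} (h : |a| ≤ b) : |Real.arctan a| ≤ Real.arctan b := by
  rw [abs_le] at h ⊢
  exact ⟨by rw [← Real.arctan_neg]; exact Real.arctan_strictMono.monotone h.1,
    Real.arctan_strictMono.monotone h.2⟩

lemma integrable_of_continuousAt_off_finite {g : ℝ → ℝ} {N : Set ℝ} {B : ℝ} (hN : N.Finite)
    (hc : ∀ x ∉ N, ContinuousAt g x) (hB : ∀ x ∉ N, |g x| ≤ B)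
    (h0 : ∀ x, x ∉ Set.Ioo (-1 : ℝ) 1 → g x = 0) : Integrable g := by
  have hae : ∀ᵐ x, x ∈ Nᶜ := hN.countable.ae_notMem volume
  have hmeas : AEStronglyMeasurable g := by
    have h : ContinuousOn g Nᶜ := fun x hx => (hc x hx).continuousWithinAt
    rw [← Measure.restrict_eq_self_of_ae_mem hae]
    exact h.aestronglyMeasurable hN.measurableSet.compl
  have h : IntegrableOn g (Set.Ioo (-1 : ℝ) 1) :=
    Measure.integrableOn_of_bounded (by simp) hmeas
      (ae_restrict_of_ae (hae.mono fun x hx => hB x hx))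
  exact (integrableOn_iff_integrable_of_support_subset fun x hx => by
    by_contra hx'
    exact hx (h0 x hx')).1 h

lemma im_exp_boundaryExponent (θ : ℝ → ℝ) {x c r φ : ℝ}
    (hlog : Complex.log ((x - 1 : ℝ) : ℂ) - Complex.log ((x + 1 : ℝ) : ℂ) = r + φ * I) :
    (cexp (boundaryExponent θ c x)).im
      = Real.exp (c / π * r + HT θ x) * Real.sin (c / π * φ + θ x) := by
  have h : boundaryExponent θ c x
      = (c / π * r + HT θ x : ℝ) + (c / π * φ + θ x : ℝ) * I := by
    rw [boundaryExponent, hlog]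
    push_cast
    ring
  rw [h, Complex.exp_im]
  simp

lemma log_sub_one_sub_log_add_one_of_one_lt_abs {x : ℝ} (hx : 1 < |x|) :
    Complex.log ((x - 1 : ℝ) : ℂ) - Complex.log ((x + 1 : ℝ) : ℂ)
      = (Real.log (x - 1) - Real.log (x + 1) : ℝ) + (0 : ℝ) * I := by
  rcases lt_abs.1 hx with h | h
  · rw [← ofReal_log (by linarith), ← ofReal_log (by linarith)]
    push_cast
    ring
  · rw [Complex.log_ofReal_of_neg (by linarith), Complex.log_ofReal_of_neg (by linarith),
      Real.log_neg_eq_log, Real.log_neg_eq_log]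
    push_cast
    ring

lemma log_sub_one_sub_log_add_one_of_mem_Ioo {x : ℝ} (hx : x ∈ Set.Ioo (-1 : ℝ) 1) :
    Complex.log ((x - 1 : ℝ) : ℂ) - Complex.log ((x + 1 : ℝ) : ℂ)
      = (Real.log (1 - x) - Real.log (1 + x) : ℝ) + π * I := by
  rw [Complex.log_ofReal_of_neg (by linarith [hx.2]), ← ofReal_log (by linarith [hx.1]),
    neg_sub, add_comm x 1]
  push_cast
  ring

lemma exp_half_log_add_exp_neg_half_log {a b : ℝ} (ha : 0 < a) (hb : 0 < b) :
    Real.exp ((Real.log a - Real.log b) / 2) + Real.exp (-((Real.log a - Real.log b) / 2))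
      = (a + b) / √(a * b) := by
  have hsqrt : ∀ {c : ℝ}, 0 < c → Real.exp (Real.log c / 2) = √c := fun hc => by
    rw [Real.exp_half, Real.exp_log hc]
  have h1 : (Real.log a - Real.log b) / 2 = Real.log a / 2 - Real.log b / 2 := by ring
  rw [h1, neg_sub, Real.exp_sub, Real.exp_sub, hsqrt ha, hsqrt hb, Real.sqrt_mul ha.le]
  have hsa := Real.sqrt_pos.2 ha
  have hsb := Real.sqrt_pos.2 hb
  rw [div_add_div _ _ hsb.ne' hsa.ne', Real.mul_self_sqrt ha.le, Real.mul_self_sqrt hb.le,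
    mul_comm √b]

lemma im_exp_boundaryExponent_sub_of_one_lt_abs {θ : ℝ → ℝ} {x : ℝ} (hx : 1 < |x|)
    (hθ : θ x = 0) :
    (cexp (boundaryExponent θ (π / 2) x) - cexp (boundaryExponent θ (-(π / 2)) x)).im = 0 := by
  have h := log_sub_one_sub_log_add_one_of_one_lt_abs hx
  rw [sub_im, im_exp_boundaryExponent θ h, im_exp_boundaryExponent θ h]
  simp [hθ]

lemma im_exp_boundaryExponent_sub_of_mem_Ioo (θ : ℝ → ℝ) {x : ℝ} (hx : x ∈ Set.Ioo (-1 : ℝ) 1) :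
    (cexp (boundaryExponent θ (π / 2) x) - cexp (boundaryExponent θ (-(π / 2)) x)).im
      = 2 * (Real.exp (HT θ x) * Real.cos (θ x) / √(1 - x ^ 2)) := by
  have h := log_sub_one_sub_log_add_one_of_mem_Ioo hx
  have hadd := exp_half_log_add_exp_neg_half_log (show 0 < 1 - x by linarith [hx.2])
    (show 0 < 1 + x by linarith [hx.1])
  rw [show (1 - x) + (1 + x) = 2 by ring, show (1 - x) * (1 + x) = 1 - x ^ 2 by ring] at hadd
  rw [sub_im, im_exp_boundaryExponent θ h, im_exp_boundaryExponent θ h]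
  have hpi : π / 2 / π = 1 / 2 := by field_simp
  have hs1 : Real.sin (1 / 2 * π + θ x) = Real.cos (θ x) := by
    rw [show 1 / 2 * π + θ x = θ x + π / 2 by ring, Real.sin_add_pi_div_two]
  have hs2 : Real.sin (-(1 / 2) * π + θ x) = -Real.cos (θ x) := by
    rw [show -(1 / 2) * π + θ x = θ x - π / 2 by ring, Real.sin_sub_pi_div_two]
  rw [neg_div, hpi, hs1, hs2, Real.exp_add, Real.exp_add]
  set r := Real.log (1 - x) - Real.log (1 + x)
  rw [show 1 / 2 * r = r / 2 by ring, show -(1 / 2) * r = -(r / 2) by ring]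
  linear_combination (Real.exp (HT θ x) * Real.cos (θ x)) * hadd

/-- Holomorphic representation of the Cauchy integral of `t₀`
in the upper half-plane: `(1/π)·∫_{-1}^1 t₀(s)/(s-z) ds
= (1/2π)·(e^{φ⁺(z)} - e^{φ⁻(z)})` for `Im z > 0`. -/
theorem stmt4 (f : ℝ → ℝ)
    (hf_pl : PiecewiseLipschitzOn f)
    (hf_zero : ∀ x, x ∉ Set.Ioo (-1:ℝ) 1 → f x = 0)
    (τ : ℝ → ℝ) (hτ : τ = HT (fun s => Real.arctan (f s)))
    (t0 : ℝ → ℝ)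
    (ht0 : ∀ x, t0 x = if x ∈ Set.Ioo (-1:ℝ) 1 then
      Real.exp (τ x) / (Real.pi * Real.sqrt (1 - x ^ 2) * Real.sqrt (1 + f x ^ 2))
      else 0)
    (φp φm : ℂ → ℂ)
    (hφp : ∀ z : ℂ, φp z = (1 / (Real.pi : ℂ)) *
      ∫ s in (-1:ℝ)..1, ((Real.pi / 2 + Real.arctan (f s) : ℝ) : ℂ) / ((s : ℂ) - z))
    (hφm : ∀ z : ℂ, φm z = (1 / (Real.pi : ℂ)) *
      ∫ s in (-1:ℝ)..1, ((-(Real.pi / 2) + Real.arctan (f s) : ℝ) : ℂ) / ((s : ℂ) - z)) :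
    ∀ z : ℂ, 0 < z.im →
      (1 / (Real.pi : ℂ)) * ∫ s in (-1:ℝ)..1, (t0 s : ℂ) / ((s : ℂ) - z)
        = (1 / (2 * (Real.pi : ℂ))) * (Complex.exp (φp z) - Complex.exp (φm z)) := by
  intro z hz
  obtain ⟨N, hN, B, hNB⟩ := hf_pl.exists_finite hf_zero
  have hθ0 : ∀ s, s ∉ Set.Ioo (-1 : ℝ) 1 → Real.arctan (f s) = 0 := fun s hs => by
    rw [hf_zero s hs, Real.arctan_zero]
  have hbound : ∀ x ∉ N, |Real.arctan (f x)| ≤ Real.arctan B := fun x hx =>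
    Real.abs_arctan_le (hNB x hx).1
  have hlip : ∀ x ∉ N, ∃ δ > 0, ∃ K, ∀ s, |s - x| ≤ δ →
      |Real.arctan (f s) - Real.arctan (f x)| ≤ K * |s - x| := fun x hx => by
    obtain ⟨δ, hδ, K, hK⟩ := (hNB x hx).2
    exact ⟨δ, hδ, K, fun s hs => (Real.abs_arctan_sub_arctan_le _ _).trans (hK s hs)⟩
  have hcont : ∀ x ∉ N, ContinuousAt (fun s => Real.arctan (f s)) x := fun x hx => by
    obtain ⟨δ, hδ, K, hK⟩ := hlip x hx
    exact continuousAt_of_locally_lipschitz hδ K fun s hs => hK s (by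
      rw [Real.dist_eq] at hs
      exact hs.le)
  have hae : ∀ᵐ x, x ∉ N := hN.countable.ae_notMem volume
  rw [hφp, hφm]
  refine cauchyTransform_eq_exp_sub_exp (θ := fun s => Real.arctan (f s))
    (integrable_of_continuousAt_off_finite hN hcont hbound hθ0) hθ0 (hae.mono hlip)
    (hae.mono hbound) (Real.arctan_lt_pi_div_two B)
    (fun s hs => by rw [ht0, if_neg hs]) ?_ hz
  filter_upwards [(Set.toFinite {(-1 : ℝ), 1}).countable.ae_notMem volume] with x hx
  rw [ht0 x]
  split_ifs with h
  · rw [im_exp_boundaryExponent_sub_of_mem_Ioo _ h, Real.cos_arctan, ← hτ]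
    have := Real.pi_ne_zero
    field_simp
  · rw [mul_zero]
    refine im_exp_boundaryExponent_sub_of_one_lt_abs ?_ (hθ0 x h)
    by_contra! hle
    rw [Set.mem_insert_iff, Set.mem_singleton_iff, not_or] at hx
    rw [abs_le] at hle
    exact h ⟨lt_of_le_of_ne hle.1 (Ne.symm hx.1), lt_of_le_of_ne hle.2 hx.2⟩
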